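/- Let H be a complex Hilbert space and φ : ℝ → B(H) locally Bochner integrable. Define the dyadic column BMO norms ‖φ‖_{BMO_c^D} and ‖φ‖_{BMO_c^{D'}} by taking, in the definition of ‖φ‖_{BMO_c}, the supremum only over intervals I that are atoms D_n^k of the usual dyadic partitions, respectively atoms D'_n^k of the shifted dyadic partitions. Then max( ‖φ‖_{BMO_c^D}, ‖φ‖_{BMO_c^{D'}} ) ≤ ‖φ‖_{BMO_c} ≤ 4√3 · max( ‖φ‖_{BMO_c^D}, ‖φ‖_{BMO_c^{D'}} ), the inequalities understood in [0,∞]. -/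

import Mathlib

open MeasureTheory

variable {H : Type*} [NormedAddCommGroup H] [InnerProductSpace ℂ H] [CompleteSpace H]

/-- The average `φ_I = (1/|I|) ∫_I φ` of an operator-valued function over the interval
`I = (a, b]`. -/
noncomputable def intervalAvg (φ : ℝ → H →L[ℂ] H) (a b : ℝ) : H →L[ℂ] H :=
  (b - a)⁻¹ • ∫ s in Set.Ioc a b, φ s

/-- `((1/|I|) ∫_I ‖(φ(s) − φ_I) v‖² ds)^{1/2}` for the interval `I = (a, b]`. -/
noncomputable def bmoOn (φ : ℝ → H →L[ℂ] H) (a b : ℝ) (v : H) : ℝ :=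
  Real.sqrt ((b - a)⁻¹ * ∫ s in Set.Ioc a b, ‖(φ s - intervalAvg φ a b) v‖ ^ 2)

/-- The column BMO norm of `φ : ℝ → B(H)`: the supremum of `bmoOn φ a b v` over all bounded
intervals `(a, b]` and unit vectors `v`, as a value in `[0, ∞]`. -/
noncomputable def bmoCNorm (φ : ℝ → H →L[ℂ] H) : ENNReal :=
  ⨆ (a : ℝ) (b : ℝ) (_ : a < b) (v : H) (_ : ‖v‖ ≤ 1), ENNReal.ofReal (bmoOn φ a b v)

/-- The left endpoint `k·2^{-n}` of the atom `D_n^k` of the usual dyadic partition. -/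
noncomputable def dyadicL (n k : ℤ) : ℝ := (k : ℝ) * (2 : ℝ) ^ (-n)

/-- The left endpoint of the atom `D'_n^k` of the shifted dyadic partition:
`(k+1/3)·2^{-n}` for even `n` and `(k+2/3)·2^{-n}` for odd `n`. -/
noncomputable def dyadicL' (n k : ℤ) : ℝ :=
  if Even n then ((k : ℝ) + 1 / 3) * (2 : ℝ) ^ (-n) else ((k : ℝ) + 2 / 3) * (2 : ℝ) ^ (-n)

/-- The dyadic column BMO norm of `φ`: the supremum in the definition of `bmoCNorm` is taken
only over the atoms `D_n^k = (k·2^{-n}, (k+1)·2^{-n}]` of the usual dyadic partitions. -/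
noncomputable def bmoCNormD (φ : ℝ → H →L[ℂ] H) : ENNReal :=
  ⨆ (n : ℤ) (k : ℤ) (v : H) (_ : ‖v‖ ≤ 1),
    ENNReal.ofReal (bmoOn φ (dyadicL n k) (dyadicL n k + (2 : ℝ) ^ (-n)) v)

/-- The shifted dyadic column BMO norm of `φ`: the supremum in the definition of `bmoCNorm` is
taken only over the atoms `D'_n^k` of the shifted dyadic partitions. -/
noncomputable def bmoCNormD' (φ : ℝ → H →L[ℂ] H) : ENNReal :=
  ⨆ (n : ℤ) (k : ℤ) (v : H) (_ : ‖v‖ ≤ 1),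
    ENNReal.ofReal (bmoOn φ (dyadicL' n k) (dyadicL' n k + (2 : ℝ) ^ (-n)) v)


section Core
variable {E : Type*} [NormedAddCommGroup E] [InnerProductSpace ℝ E] [CompleteSpace E]

noncomputable def avgS (f : ℝ → E) (x s : ℝ) : E := s⁻¹ • ∫ y in Set.Ioc x (x + s), f y

noncomputable def devS (f : ℝ → E) (x z : ℝ) (c : E) : ℝ := ∫ y in Set.Ioc x z, ‖f y - c‖ ^ 2

/-- `f` is square integrable on `(a, b]`. -/
def SqInt (f : ℝ → E) (a b : ℝ) : Prop :=
  IntegrableOn f (Set.Ioc a b) ∧ ∀ c : E, IntegrableOn (fun y => ‖f y - c‖ ^ 2) (Set.Ioc a b)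

lemma SqInt.mono {f : ℝ → E} {a b x z : ℝ} (h : SqInt f a b) (hx : a ≤ x) (hz : z ≤ b) :
    SqInt f x z :=
  ⟨h.1.mono_set (Set.Ioc_subset_Ioc hx hz), fun c => (h.2 c).mono_set (Set.Ioc_subset_Ioc hx hz)⟩

lemma devS_nonneg (f : ℝ → E) (x z : ℝ) (c : E) : 0 ≤ devS f x z c :=
  integral_nonneg fun _ => by positivity

lemma vol_Ioc {x z : ℝ} (h : x ≤ z) : volume.real (Set.Ioc x z) = z - x := by
  rw [Measure.real, Real.volume_Ioc, ENNReal.toReal_ofReal (by linarith)]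

lemma devS_split {f : ℝ → E} {x y z : ℝ} (h : SqInt f x z) (hxy : x ≤ y) (hyz : y ≤ z) (c : E) :
    devS f x z c = devS f x y c + devS f y z c := by
  unfold devS
  rw [← Set.Ioc_union_Ioc_eq_Ioc hxy hyz, setIntegral_union (Set.Ioc_disjoint_Ioc_of_le le_rfl)
    measurableSet_Ioc ((h.mono le_rfl hyz).2 c) ((h.mono hxy le_rfl).2 c)]

lemma int_split {f : ℝ → E} {x y z : ℝ} (h : SqInt f x z) (hxy : x ≤ y) (hyz : y ≤ z) :
    ∫ w in Set.Ioc x z, f w = (∫ w in Set.Ioc x y, f w) + ∫ w in Set.Ioc y z, f w := by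
  rw [← Set.Ioc_union_Ioc_eq_Ioc hxy hyz, setIntegral_union (Set.Ioc_disjoint_Ioc_of_le le_rfl)
    measurableSet_Ioc ((h.mono le_rfl hyz).1) ((h.mono hxy le_rfl).1)]

lemma int_sub_const {f : ℝ → E} {x z : ℝ} (h : SqInt f x z) (hxz : x ≤ z) (c : E) :
    ∫ w in Set.Ioc x z, (f w - c) = (∫ w in Set.Ioc x z, f w) - (z - x) • c := by
  rw [integral_sub h.1 (by simp), setIntegral_const, vol_Ioc hxz]

/-- Expansion of the square deviation. -/
lemma devS_expand {f : ℝ → E} {x z : ℝ} (h : SqInt f x z) (hxz : x ≤ z) (c d : E) :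
    devS f x z (c + d) = devS f x z c - 2 * inner ℝ d ((∫ w in Set.Ioc x z, f w) - (z - x) • c)
      + (z - x) * ‖d‖ ^ 2 := by
  have hi : IntegrableOn (fun w => f w - c) (Set.Ioc x z) := h.1.sub (by simp)
  have e : ∀ y, ‖f y - (c + d)‖ ^ 2 = ‖f y - c‖ ^ 2 - 2 * inner ℝ d (f y - c) + ‖d‖ ^ 2 := by
    intro y
    rw [← sub_sub, norm_sub_sq_real, real_inner_comm]
  have hii : IntegrableOn (fun w => 2 * inner ℝ d (f w - c)) (Set.Ioc x z) :=
    (hi.const_inner d).const_mul 2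
  have h3 : IntegrableOn (fun w => ‖f w - c‖ ^ 2 - 2 * inner ℝ d (f w - c)) (Set.Ioc x z) :=
    (h.2 c).sub hii
  unfold devS
  simp_rw [e]
  rw [integral_add h3 (integrable_const _), integral_sub (h.2 c) hii, integral_const_mul,
    integral_inner hi, setIntegral_const, vol_Ioc hxz, int_sub_const h hxz, smul_eq_mul]

/-- Cauchy-Schwarz. -/
lemma cs_dev {f : ℝ → E} {x z : ℝ} (h : SqInt f x z) (hxz : x < z) (c : E) :
    ‖(∫ w in Set.Ioc x z, f w) - (z - x) • c‖ ^ 2 ≤ (z - x) * devS f x z c := by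
  set v := (∫ w in Set.Ioc x z, f w) - (z - x) • c with hv
  have h0 : 0 < z - x := by linarith
  have := devS_nonneg f x z (c + (z - x)⁻¹ • v)
  rw [devS_expand h hxz.le, ← hv, real_inner_smul_left, real_inner_self_eq_norm_sq, norm_smul,
    mul_pow, Real.norm_eq_abs, sq_abs] at this
  have e : (z - x) * (devS f x z c - 2 * ((z - x)⁻¹ * ‖v‖ ^ 2) + (z - x) * ((z - x)⁻¹ ^ 2 * ‖v‖ ^ 2))
      = (z - x) * devS f x z c - ‖v‖ ^ 2 := by
    field_simp; ring
  nlinarith [mul_nonneg h0.le this]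

lemma avg_int {f : ℝ → E} {x s : ℝ} (hs : 0 < s) :
    ∫ w in Set.Ioc x (x + s), f w = s • avgS f x s := by
  unfold avgS; rw [smul_smul, mul_inv_cancel₀ hs.ne', one_smul]

/-- Deviation of the mean on a part of an interval, the left part. -/
lemma part_dev {f : ℝ → E} {x y z K : ℝ} (h : SqInt f x z) (hxy : x < y) (hyz : y < z) (c : E)
    (hc : ∫ w in Set.Ioc x z, f w = (z - x) • c) (hK : devS f x z c ≤ K * (z - x)) :
    ‖(∫ w in Set.Ioc x y, f w) - (y - x) • c‖ ^ 2 ≤ K * (y - x) * (z - y) := by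
  have h1 := cs_dev (h.mono le_rfl hyz.le) hxy c
  have h2 := cs_dev (h.mono hxy.le le_rfl) hyz c
  have e : (∫ w in Set.Ioc y z, f w) - (z - y) • c
      = -((∫ w in Set.Ioc x y, f w) - (y - x) • c) := by
    rw [int_split h hxy.le hyz.le] at hc
    have : (∫ w in Set.Ioc y z, f w) = (z - x) • c - ∫ w in Set.Ioc x y, f w := by
      rw [← hc]; abel
    rw [this]; module
  rw [e, norm_neg] at h2
  set V := ‖(∫ w in Set.Ioc x y, f w) - (y - x) • c‖ ^ 2
  rw [devS_split h hxy.le hyz.le] at hK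
  have h0 : 0 < z - x := by linarith
  have ha : 0 < y - x := by linarith
  have hb : 0 < z - y := by linarith
  have : (z - x) * V ≤ (z - x) * (K * (y - x) * (z - y)) := by
    have m1 := mul_le_mul_of_nonneg_left h1 hb.le
    have m2 := mul_le_mul_of_nonneg_left h2 ha.le
    have m3 := mul_le_mul_of_nonneg_left hK (mul_pos ha hb).le
    nlinarith
  exact le_of_mul_le_mul_left this h0

lemma devS_tri {f : ℝ → E} {x z t : ℝ} (h : SqInt f x z) (hxz : x ≤ z) (ht : 0 < t) (c d : E) :
    devS f x z d ≤ (1 + t) * devS f x z c + (1 + 1 / t) * ‖d - c‖ ^ 2 * (z - x) := by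
  have e : ∀ y, ‖f y - d‖ ^ 2 ≤ (1 + t) * ‖f y - c‖ ^ 2 + (1 + 1 / t) * ‖d - c‖ ^ 2 := by
    intro y
    have h1 : ‖f y - d‖ ≤ ‖f y - c‖ + ‖d - c‖ := by
      have : f y - d = (f y - c) - (d - c) := by abel
      rw [this]; exact norm_sub_le _ _
    set A := ‖f y - c‖
    set B := ‖d - c‖
    have h2 : ‖f y - d‖ ^ 2 ≤ (A + B) ^ 2 := pow_le_pow_left₀ (norm_nonneg _) h1 2
    have h3 : (1 + t) * A ^ 2 + (1 + 1 / t) * B ^ 2 - (A + B) ^ 2 = (t * A - B) ^ 2 / t := by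
      field_simp; ring
    have h4 : 0 ≤ (t * A - B) ^ 2 / t := by positivity
    linarith
  unfold devS
  calc _ ≤ ∫ y in Set.Ioc x z, ((1 + t) * ‖f y - c‖ ^ 2 + (1 + 1 / t) * ‖d - c‖ ^ 2) :=
        integral_mono (h.2 d) (((h.2 c).const_mul _).add (integrable_const _)) e
    _ = _ := by
        rw [integral_add ((h.2 c).const_mul _) (integrable_const _), integral_const_mul, setIntegral_const,
          vol_Ioc hxz, smul_eq_mul]
        ring

lemma devS_tri' {f : ℝ → E} {a' z t : ℝ} {a b : ℝ} (h : SqInt f a b) (ha : a ≤ a') (hz : z ≤ b)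
    (haz : a ≤ z) (ht : 0 < t) (c d : E) :
    devS f a' z d ≤ (1 + t) * devS f a' z c + (1 + 1 / t) * ‖d - c‖ ^ 2 * (z - a) := by
  rcases le_total a' z with h1 | h1
  · refine (devS_tri (h.mono ha hz) h1 ht c d).trans ?_
    have : 0 ≤ (1 + 1 / t) * ‖d - c‖ ^ 2 := by positivity
    nlinarith
  · have : devS f a' z d = 0 := by unfold devS; rw [Set.Ioc_eq_empty (by linarith)]; simp
    rw [this]
    have := devS_nonneg f a' z c
    have : 0 ≤ z - a := by linarith
    positivity

lemma stepSub {f : ℝ → E} {a b a' p l K t : ℝ} (h : SqInt f a b) (ha : a ≤ a') (hp : a ≤ p)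
    (hb : p + l ≤ b) (hl : 0 < l) (ht : 0 < t)
    (hJ : devS f p (p + l) (avgS f p l) ≤ K * l) :
    devS f a' p (avgS f p l) ≤ (1 + t) * devS f a' p (avgS f p (l / 2))
      + (1 + 1 / t) * K * (p - a) := by
  refine (devS_tri' h ha (by linarith) hp ht (avgS f p (l / 2)) _).trans ?_
  have hd := part_dev (x := p) (y := p + l / 2) (z := p + l) (K := K) (h.mono hp hb) (by linarith)
    (by linarith) (avgS f p l) (by rw [avg_int hl]; congr 1; ring) (by convert hJ using 2; ring)
  rw [avg_int (by linarith)] at hd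
  have e : (l / 2) • avgS f p (l / 2) - (p + l / 2 - p) • avgS f p l
      = (-(l / 2)) • (avgS f p l - avgS f p (l / 2)) := by module
  rw [e, norm_smul, mul_pow, Real.norm_eq_abs, sq_abs] at hd
  have : ‖avgS f p l - avgS f p (l / 2)‖ ^ 2 ≤ K := by
    have : (l / 2) ^ 2 * ‖avgS f p l - avgS f p (l / 2)‖ ^ 2 ≤ (l / 2) ^ 2 * K := by nlinarith
    exact le_of_mul_le_mul_left this (by positivity)
  have h1 : 0 ≤ (1 + 1 / t) * (p - a) := mul_nonneg (by positivity) (by linarith)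
  nlinarith

lemma stepB {f : ℝ → E} {a b a' p l u s K t q : ℝ} (h : SqInt f a b) (ha : a ≤ a')
    (hp : a ≤ p - u) (hK : 0 ≤ K)
    (hb : p + l ≤ b) (hu : 0 < u) (hus : u < s) (hsl : s - u < l) (ht : 0 < t)
    (hJ : devS f p (p + l) (avgS f p l) ≤ K * l)
    (hB : devS f (p - u) (p - u + s) (avgS f (p - u) s) ≤ K * s)
    (hq : 0 ≤ q) (hq2 : u * (l - (s - u)) ≤ q ^ 2 * (s - u) ^ 2) :
    devS f a' p (avgS f p l) ≤
      K * (s + s * (u / (s - u)) + 2 * s * q + u * ((l - (s - u)) / (s - u)))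
      + (1 + t) * devS f a' (p - u) (avgS f (p - u) s)
      + (1 + 1 / t) * (K * (u / (s - u) + (l - (s - u)) / (s - u) + 2 * q)) * (p - u - a) := by
  obtain ⟨e, he⟩ : ∃ e, e = s - u := ⟨_, rfl⟩
  rw [← he] at hsl hq2 ⊢
  have he0 : 0 < e := by linarith
  have hl : 0 < l := by linarith
  have hs : 0 < s := by linarith
  set cJ := avgS f p l with hcJ
  set cB := avgS f (p - u) s with hcB
  set m := avgS f p e with hm
  have hSJ : SqInt f p (p + l) := h.mono (by linarith) hb
  have hSB : SqInt f (p - u) (p + e) := h.mono (by linarith) (by linarith)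
  have hpe : p - u + s = p + e := by linarith
  have intE : ∫ w in Set.Ioc p (p + e), f w = e • m := avg_int he0
  have intB : ∫ w in Set.Ioc (p - u) (p + e), f w = s • cB := by
    rw [← hpe]; exact avg_int hs
  have intO : ∫ w in Set.Ioc (p - u) p, f w = s • cB - e • m := by
    rw [← intB, ← intE, int_split hSB (y := p) (by linarith) (by linarith)]; abel
  rw [hpe] at hB
  -- the two jumps
  have hz := part_dev (x := p) (y := p + e) (z := p + l) (K := K) hSJ (by linarith)
    (by linarith) cJ (by rw [avg_int hl]; congr 1; ring) (by convert hJ using 2; ring)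
  rw [intE] at hz
  have ez : e • m - (p + e - p) • cJ = (-e) • (cJ - m) := by module
  rw [ez, norm_smul, mul_pow, Real.norm_eq_abs, sq_abs] at hz
  have hw := part_dev (x := p - u) (y := p) (z := p + e) (K := K) hSB (by linarith)
    (by linarith) cB (by rw [intB]; congr 1; linarith) (by convert hB using 2; linarith)
  rw [intO] at hw
  have ew : s • cB - e • m - (p - (p - u)) • cB = (-e) • (m - cB) := by
    rw [show s = e + u by linarith]; module
  rw [ew, norm_smul, mul_pow, Real.norm_eq_abs, sq_abs] at hw
  set z := cJ - m with hzd
  set w := m - cB with hwd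
  have hz2 : ‖z‖ ^ 2 ≤ K * ((l - e) / e) := by
    have : e ^ 2 * ‖z‖ ^ 2 ≤ e ^ 2 * (K * ((l - e) / e)) := by
      have : e ^ 2 * (K * ((l - e) / e)) = K * e * (l - e) := by field_simp
      rw [this]; nlinarith
    exact le_of_mul_le_mul_left this (by positivity)
  have hw2 : ‖w‖ ^ 2 ≤ K * (u / e) := by
    have : e ^ 2 * ‖w‖ ^ 2 ≤ e ^ 2 * (K * (u / e)) := by
      have : e ^ 2 * (K * (u / e)) = K * u * e := by field_simp
      rw [this]; nlinarith
    exact le_of_mul_le_mul_left this (by positivity)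
  have hzw : ‖w‖ * ‖z‖ ≤ K * q := by
    apply abs_le_of_sq_le_sq' _ (by positivity) |>.2
    have h1 : ‖w‖ ^ 2 * ‖z‖ ^ 2 ≤ (K * (u / e)) * (K * ((l - e) / e)) := by gcongr
    have h2 : (K * (u / e)) * (K * ((l - e) / e)) = K ^ 2 * ((u * (l - e)) / e ^ 2) := by
      field_simp
    have h3 : (u * (l - e)) / e ^ 2 ≤ q ^ 2 := by
      rw [div_le_iff₀ (by positivity)]; exact hq2
    calc (‖w‖ * ‖z‖) ^ 2 = ‖w‖ ^ 2 * ‖z‖ ^ 2 := by ring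
      _ ≤ K ^ 2 * ((u * (l - e)) / e ^ 2) := by rw [← h2]; exact h1
      _ ≤ K ^ 2 * q ^ 2 := by gcongr
      _ = (K * q) ^ 2 := by ring
  have hin : inner ℝ w z ≤ K * q := (real_inner_le_norm w z).trans hzw
  -- middle piece
  have hmid : devS f (p - u) p cJ ≤ K * (s + s * (u / e) + 2 * s * q + u * ((l - e) / e)) := by
    have hc : cJ = cB + (w + z) := by rw [hzd, hwd]; abel
    have hcs := cs_dev (hSB.mono (x := p) (by linarith) le_rfl) (by linarith) cB
    rw [intE] at hcs
    have e1 : e • m - (p + e - p) • cB = e • w := by rw [hwd]; module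
    rw [e1, norm_smul, mul_pow, Real.norm_eq_abs, sq_abs] at hcs
    have hcs' : e * ‖w‖ ^ 2 ≤ devS f p (p + e) cB := by
      have : e * (e * ‖w‖ ^ 2) ≤ e * devS f p (p + e) cB := by nlinarith
      exact le_of_mul_le_mul_left this he0
    rw [devS_split hSB (y := p) (by linarith) (by linarith)] at hB
    rw [hc, devS_expand (hSB.mono le_rfl (by linarith)) (by linarith), intO, ew,
      real_inner_smul_right, inner_add_left, real_inner_self_eq_norm_sq, norm_add_sq_real,
      real_inner_comm w z]
    have hs' : s = e + u := by linarith
    have k1 := mul_le_mul_of_nonneg_left hw2 hs.le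
    have k2 := mul_le_mul_of_nonneg_left hin hs.le
    have k3 := mul_le_mul_of_nonneg_left hz2 hu.le
    have : (p - (p - u)) = u := by ring
    rw [this]
    have k4 : K * (s + s * (u / e) + 2 * s * q + u * ((l - e) / e))
        = K * s + s * (K * (u / e)) + 2 * (s * (K * q)) + u * (K * ((l - e) / e)) := by ring
    have k5 : ∀ X : ℝ, s * X = e * X + u * X := fun X => by rw [hs']; ring
    have k6 := k5 (‖w‖ ^ 2)
    have k7 := k5 (inner ℝ w z)
    rw [k4]
    linarith
  have hfar := devS_tri' (a' := a') (z := p - u) h ha (by linarith) hp ht cB cJ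
  have hd : ‖cJ - cB‖ ^ 2 ≤ K * (u / e + (l - e) / e + 2 * q) := by
    have : cJ - cB = w + z := by rw [hzd, hwd]; abel
    rw [this, norm_add_sq_real]
    linarith
  have hfar' : (1 + 1 / t) * ‖cJ - cB‖ ^ 2 * (p - u - a) ≤
      (1 + 1 / t) * (K * (u / e + (l - e) / e + 2 * q)) * (p - u - a) := by
    have : 0 ≤ p - u - a := by linarith
    gcongr
  have hsplit : devS f a' p cJ ≤ devS f (p - u) p cJ + devS f a' (p - u) cJ := by
    rcases le_total a' (p - u) with h1 | h1
    · rw [devS_split (h.mono ha (by linarith)) h1 (by linarith)]; linarith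
    · have : devS f a' p cJ ≤ devS f (p - u) p cJ :=
        setIntegral_mono_set ((h.mono hp (by linarith)).2 cJ)
          (Filter.Eventually.of_forall fun _ => by positivity)
          (LE.le.eventuallyLE (Set.Ioc_subset_Ioc h1 le_rfl))
      linarith [devS_nonneg f a' (p - u) cJ]
  linarith
end Core

section Rows
variable {E : Type*} [NormedAddCommGroup E] [InnerProductSpace ℝ E] [CompleteSpace E]

/-- All grid intervals of the grid through `p` with scales `ℓ / 2 ^ k` inside `(a, b]` are good. -/
def Gd (f : ℝ → E) (a b K p l : ℝ) : Prop :=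
  ∀ (k : ℕ) (m : ℤ), a ≤ p + m * (l / 2 ^ k) → p + m * (l / 2 ^ k) + l / 2 ^ k ≤ b →
    devS f (p + m * (l / 2 ^ k)) (p + m * (l / 2 ^ k) + l / 2 ^ k)
      (avgS f (p + m * (l / 2 ^ k)) (l / 2 ^ k)) ≤ K * (l / 2 ^ k)

lemma Gd.self {f : ℝ → E} {a b K p l : ℝ} (h : Gd f a b K p l) (ha : a ≤ p) (hb : p + l ≤ b) :
    devS f p (p + l) (avgS f p l) ≤ K * l := by
  have := h 0 0
  simp only [Int.cast_zero, zero_mul, add_zero, pow_zero, div_one] at this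
  exact this ha hb

lemma Gd.shift {f : ℝ → E} {a b K p l : ℝ} (h : Gd f a b K p l) (j : ℤ) {p' : ℝ}
    (hp : p' = p + j * l) : Gd f a b K p' l := by
  intro k m
  have e : p' + m * (l / 2 ^ k) = p + ((m + j * 2 ^ k : ℤ) : ℝ) * (l / 2 ^ k) := by
    rw [hp]; push_cast; field_simp; ring
  rw [e]
  exact h k (m + j * 2 ^ k)

lemma Gd.half {f : ℝ → E} {a b K p l : ℝ} (h : Gd f a b K p l) {l' : ℝ} (hl : l' = l / 2) :
    Gd f a b K p l' := by
  intro k m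
  have e : l' / 2 ^ k = l / 2 ^ (k + 1) := by rw [hl, pow_succ]; field_simp
  rw [e]
  exact h (k + 1) m

def SX (f : ℝ → E) (a b K p l : ℝ) : Prop := Gd f a b K p l ∧ Gd f a b K (p - l / 3) l
def SY (f : ℝ → E) (a b K p l : ℝ) : Prop := Gd f a b K p l ∧ Gd f a b K (p + l / 3) l

lemma SX.half {f : ℝ → E} {a b K p l : ℝ} (h : SX f a b K p l) : SY f a b K p (l / 2) :=
  ⟨h.1.half rfl, (h.2.half rfl).shift 1 (by push_cast; ring)⟩
lemma SY.half {f : ℝ → E} {a b K p l : ℝ} (h : SY f a b K p l) : SX f a b K p (l / 2) :=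
  ⟨h.1.half rfl, (h.2.half rfl).shift (-1) (by push_cast; ring)⟩
lemma SX.toY {f : ℝ → E} {a b K p l : ℝ} (h : SX f a b K p l) : SY f a b K (p - l / 3) l :=
  ⟨h.2, h.1.shift 0 (by push_cast; ring)⟩
lemma SY.toX {f : ℝ → E} {a b K p l : ℝ} (h : SY f a b K p l) : SX f a b K (p - 2 * l / 3) l :=
  ⟨h.2.shift (-1) (by push_cast; ring), h.1.shift (-1) (by push_cast; ring)⟩
lemma SY.toY {f : ℝ → E} {a b K p l : ℝ} (h : SY f a b K p l) : SY f a b K (p - l / 6) (l / 2) :=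
  ⟨(h.2.half rfl).shift (-1) (by push_cast; ring), (h.1.half rfl).shift 0 (by push_cast; ring)⟩

def PX (f : ℝ → E) (a b a' K i β l : ℝ) : Prop :=
  ∀ p, SX f a b K p l → a ≤ p → p + l ≤ b → i / 6 * l ≤ p - a → p - a < (i + 1) / 6 * l →
    devS f a' p (avgS f p l) ≤ K * (48 * (p - a) + β * l)
def PY (f : ℝ → E) (a b a' K i β l : ℝ) : Prop :=
  ∀ p, SY f a b K p l → a ≤ p → p + l ≤ b → i / 6 * l ≤ p - a → p - a < (i + 1) / 6 * l →
    devS f a' p (avgS f p l) ≤ K * (48 * (p - a) + β * l)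

lemma PX.mono {f : ℝ → E} {a b a' K i β l β' : ℝ} (h : PX f a b a' K i β l) (hK : 0 ≤ K)
    (hl : 0 < l) (hb : β ≤ β') : PX f a b a' K i β' l := by
  intro p h1 h2 h3 h4 h5
  refine (h p h1 h2 h3 h4 h5).trans ?_
  gcongr
lemma PY.mono {f : ℝ → E} {a b a' K i β l β' : ℝ} (h : PY f a b a' K i β l) (hK : 0 ≤ K)
    (hl : 0 < l) (hb : β ≤ β') : PY f a b a' K i β' l := by
  intro p h1 h2 h3 h4 h5
  refine (h p h1 h2 h3 h4 h5).trans ?_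
  gcongr

lemma finSub {K r l t β β' D hi : ℝ} (hK : 0 ≤ K) (ht : 0 < t) (hl : 0 < l)
    (hr : r < hi * l) (hD : D ≤ K * (48 * r + β' * (l / 2)))
    (hc : (48 * t + 1 + 1 / t) * hi + (1 + t) * β' / 2 ≤ β) :
    (1 + t) * D + (1 + 1 / t) * K * r ≤ K * (48 * r + β * l) := by
  have h1 : (1 + t) * D ≤ (1 + t) * (K * (48 * r + β' * (l / 2))) :=
    mul_le_mul_of_nonneg_left hD (by linarith)
  have h0 : 0 ≤ 48 * t + 1 + 1 / t := by positivity
  have h2 : (48 * t + 1 + 1 / t) * r ≤ (48 * t + 1 + 1 / t) * (hi * l) :=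
    mul_le_mul_of_nonneg_left hr.le h0
  have h3 : ((48 * t + 1 + 1 / t) * hi + (1 + t) * β' / 2) * l ≤ β * l :=
    mul_le_mul_of_nonneg_right hc hl.le
  have h4 : (48 * t + 1 + 1 / t) * r + (1 + t) * β' / 2 * l ≤ β * l := by linarith
  have h5 := mul_le_mul_of_nonneg_left h4 hK
  linarith

lemma finB {K r l t β β' D hi P d μ σ : ℝ} (hK : 0 ≤ K) (ht : 0 < t) (hl : 0 < l) (hd : 0 ≤ d)
    (hr : r < hi * l) (hD : D ≤ K * (48 * r + β' * (σ * l)))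
    (hc : P + (48 * t + (1 + 1 / t) * d) * hi + (1 + t) * σ * β' ≤ 48 * μ + β) :
    K * (P * l) + (1 + t) * D + (1 + 1 / t) * (K * d) * r ≤ K * (48 * (r + μ * l) + β * l) := by
  have h1 : (1 + t) * D ≤ (1 + t) * (K * (48 * r + β' * (σ * l))) :=
    mul_le_mul_of_nonneg_left hD (by linarith)
  have h0 : 0 ≤ 48 * t + (1 + 1 / t) * d := by positivity
  have h2 : (48 * t + (1 + 1 / t) * d) * r ≤ (48 * t + (1 + 1 / t) * d) * (hi * l) :=
    mul_le_mul_of_nonneg_left hr.le h0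
  have h3 := mul_le_mul_of_nonneg_right hc hl.le
  have h4 : P * l + (48 * t + (1 + 1 / t) * d) * r + (1 + t) * σ * β' * l
      ≤ (48 * μ + β) * l := by linarith
  have h5 := mul_le_mul_of_nonneg_left h4 hK
  linarith

lemma rowXsub {f : ℝ → E} {a b a' K l : ℝ} (h : SqInt f a b) (ha : a ≤ a') (hK : 0 ≤ K)
    (hl : 0 < l) (t : ℝ) (ht : 0 < t) {i j0 j1 β β' : ℝ} (h0 : PY f a b a' K j0 β' (l / 2))
    (h1 : PY f a b a' K j1 β' (l / 2)) (e0 : j0 = 2 * i) (e1 : j1 = 2 * i + 1)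
    (hc : (48 * t + 1 + 1 / t) * ((i + 1) / 6) + (1 + t) * β' / 2 ≤ β) :
    PX f a b a' K i β l := by
  intro p hS hap hpb hlo hhi
  have hD : devS f a' p (avgS f p (l / 2)) ≤ K * (48 * (p - a) + β' * (l / 2)) := by
    subst e0 e1
    rcases lt_or_ge (p - a) ((2 * i + 1) / 6 * (l / 2)) with hh | hh
    · exact h0 p hS.half hap (by linarith) (by linarith) hh
    · exact h1 p hS.half hap (by linarith) hh (by linarith)
  exact (stepSub h ha hap hpb hl ht (hS.1.self hap hpb)).trans (finSub hK ht hl hhi hD hc)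

lemma rowYsub {f : ℝ → E} {a b a' K l : ℝ} (h : SqInt f a b) (ha : a ≤ a') (hK : 0 ≤ K)
    (hl : 0 < l) (t : ℝ) (ht : 0 < t) {i j0 j1 β β' : ℝ} (h0 : PX f a b a' K j0 β' (l / 2))
    (h1 : PX f a b a' K j1 β' (l / 2)) (e0 : j0 = 2 * i) (e1 : j1 = 2 * i + 1)
    (hc : (48 * t + 1 + 1 / t) * ((i + 1) / 6) + (1 + t) * β' / 2 ≤ β) :
    PY f a b a' K i β l := by
  intro p hS hap hpb hlo hhi
  have hD : devS f a' p (avgS f p (l / 2)) ≤ K * (48 * (p - a) + β' * (l / 2)) := by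
    subst e0 e1
    rcases lt_or_ge (p - a) ((2 * i + 1) / 6 * (l / 2)) with hh | hh
    · exact h0 p hS.half hap (by linarith) (by linarith) hh
    · exact h1 p hS.half hap (by linarith) hh (by linarith)
  exact (stepSub h ha hap hpb hl ht (hS.1.self hap hpb)).trans (finSub hK ht hl hhi hD hc)

lemma rowBX0 {f : ℝ → E} {a b a' K l : ℝ} (h : SqInt f a b) (ha : a ≤ a') (hK : 0 ≤ K)
    (hl : 0 < l) (t : ℝ) (ht : 0 < t) {i j β β' : ℝ} (hi : 0 ≤ i) (h0 : PY f a b a' K i β' l)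
    (e0 : j = i + 2)
    (hc : 8 / 3 + (48 * t + (1 + 1 / t) * 2) * ((i + 1) / 6) + (1 + t) * 1 * β' ≤ 48 * (1 / 3) + β) :
    PX f a b a' K j β l := by
  intro p hS hap hpb hlo hhi
  subst e0
  have hlo' : 0 ≤ i / 6 * l := by positivity
  have hS' := hS.toY
  have hD := h0 (p - l / 3) hS' (by linarith) (by linarith) (by linarith) (by linarith)
  have := stepB (f := f) (a := a) (b := b) (a' := a') (p := p) (l := l) (u := l / 3) (s := l) (K := K)
    (t := t) (q := 1 / 2) h ha (by linarith) hK hpb (by linarith) (by linarith) (by linarith) ht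
    (hS.1.self hap hpb) (hS'.1.self (by linarith) (by linarith)) (by norm_num)
    (by nlinarith)
  refine this.trans ?_
  have e1 : l + l * (l / 3 / (l - l / 3)) + 2 * l * (1 / 2)
      + l / 3 * ((l - (l - l / 3)) / (l - l / 3)) = 8 / 3 * l := by
    have : l - l / 3 = l * (2 / 3) := by ring
    rw [this]; field_simp; ring
  have e2 : l / 3 / (l - l / 3) + (l - (l - l / 3)) / (l - l / 3) + 2 * (1 / 2) = 2 := by
    have : l - l / 3 = l * (2 / 3) := by ring
    rw [this]; field_simp; ring
  rw [e1, e2]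
  refine (finB hK ht hl (by norm_num) (by linarith) (by linarith) hc).trans (le_of_eq ?_)
  ring

lemma rowBY0 {f : ℝ → E} {a b a' K l : ℝ} (h : SqInt f a b) (ha : a ≤ a') (hK : 0 ≤ K)
    (hl : 0 < l) (t : ℝ) (ht : 0 < t) {i j β β' : ℝ} (hi : 0 ≤ i) (h0 : PX f a b a' K i β' l)
    (e0 : j = i + 4)
    (hc : 25 / 3 + (48 * t + (1 + 1 / t) * 8) * ((i + 1) / 6) + (1 + t) * 1 * β'
      ≤ 48 * (2 / 3) + β) :
    PY f a b a' K j β l := by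
  intro p hS hap hpb hlo hhi
  subst e0
  have hlo' : 0 ≤ i / 6 * l := by positivity
  have hS' := hS.toX
  have hD := h0 (p - 2 * l / 3) hS' (by linarith) (by linarith) (by linarith) (by linarith)
  have := stepB (f := f) (a := a) (b := b) (a' := a') (p := p) (l := l) (u := 2 * l / 3) (s := l)
    (K := K) (t := t) (q := 2) h ha (by linarith) hK hpb (by linarith) (by linarith) (by linarith) ht
    (hS.1.self hap hpb) (hS'.1.self (by linarith) (by linarith)) (by norm_num)
    (by nlinarith)
  refine this.trans ?_
  have e : l - 2 * l / 3 = l * (1 / 3) := by ring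
  have e1 : l + l * (2 * l / 3 / (l - 2 * l / 3)) + 2 * l * 2
      + 2 * l / 3 * ((l - (l - 2 * l / 3)) / (l - 2 * l / 3)) = 25 / 3 * l := by
    rw [e]; field_simp; ring
  have e2 : 2 * l / 3 / (l - 2 * l / 3) + (l - (l - 2 * l / 3)) / (l - 2 * l / 3) + 2 * 2 = 8 := by
    rw [e]; field_simp; ring
  rw [e1, e2]
  refine (finB hK ht hl (by norm_num) (by linarith) (by linarith) hc).trans (le_of_eq ?_)
  ring

lemma rowBY1 {f : ℝ → E} {a b a' K l : ℝ} (h : SqInt f a b) (ha : a ≤ a') (hK : 0 ≤ K)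
    (hl : 0 < l) (t : ℝ) (ht : 0 < t) {i j j0 j1 β β' : ℝ} (hi : 0 ≤ i)
    (h0 : PY f a b a' K j0 β' (l / 2)) (h1 : PY f a b a' K j1 β' (l / 2))
    (e : j = i + 1) (e0 : j0 = 2 * i) (e1 : j1 = 2 * i + 1)
    (hc : 25 / 12 + (48 * t + (1 + 1 / t) * (9 / 2)) * ((i + 1) / 6) + (1 + t) * (1 / 2) * β'
      ≤ 48 * (1 / 6) + β) :
    PY f a b a' K j β l := by
  intro p hS hap hpb hlo hhi
  subst e e0 e1
  have hlo' : 0 ≤ i / 6 * l := by positivity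
  have hS' := hS.toY
  have hD : devS f a' (p - l / 6) (avgS f (p - l / 6) (l / 2))
      ≤ K * (48 * (p - l / 6 - a) + β' * (l / 2)) := by
    rcases lt_or_ge (p - l / 6 - a) ((2 * i + 1) / 6 * (l / 2)) with hh | hh
    · exact h0 _ hS' (by linarith) (by linarith) (by linarith) hh
    · exact h1 _ hS' (by linarith) (by linarith) hh (by linarith)
  have := stepB (f := f) (a := a) (b := b) (a' := a') (p := p) (l := l) (u := l / 6) (s := l / 2)
    (K := K) (t := t) (q := 1) h ha (by linarith) hK hpb (by linarith) (by linarith) (by linarith) ht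
    (hS.1.self hap hpb) (hS'.1.self (by linarith) (by linarith)) (by norm_num)
    (by nlinarith)
  refine this.trans ?_
  have e : l / 2 - l / 6 = l * (1 / 3) := by ring
  have e1 : l / 2 + l / 2 * (l / 6 / (l / 2 - l / 6)) + 2 * (l / 2) * 1
      + l / 6 * ((l - (l / 2 - l / 6)) / (l / 2 - l / 6)) = 25 / 12 * l := by
    rw [e]; field_simp; ring
  have e2 : l / 6 / (l / 2 - l / 6) + (l - (l / 2 - l / 6)) / (l / 2 - l / 6) + 2 * 1 = 9 / 2 := by
    rw [e]; field_simp; ring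
  rw [e1, e2]
  refine (finB hK ht hl (by norm_num) (by linarith) (by linarith) hc).trans (le_of_eq ?_)
  ring

/-- The full table of bounds at a scale. -/
structure Tab (f : ℝ → E) (a b a' K l : ℝ) : Prop where
  x0 : PX f a b a' K 0 (37 / 4) l
  x1 : PX f a b a' K 1 (33 / 2) l
  x2 : PX f a b a' K 2 4 l
  x3 : PX f a b a' K 3 (5 / 2) l
  x4 : PX f a b a' K 4 19 l
  x5 : PX f a b a' K 5 25 l
  x6 : PX f a b a' K 6 (19 / 4) l
  x7 : PX f a b a' K 7 (51 / 2) l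
  x8 : PX f a b a' K 8 19 l
  y0 : PY f a b a' K 0 (47 / 4) l
  y1 : PY f a b a' K 1 (29 / 4) l
  y2 : PY f a b a' K 2 (73 / 4) l
  y3 : PY f a b a' K 3 (81 / 4) l
  y4 : PY f a b a' K 4 0 l
  y5 : PY f a b a' K 5 (57 / 4) l
  y6 : PY f a b a' K 6 (23 / 4) l
  y7 : PY f a b a' K 7 (23 / 2) l

lemma Tab.step {f : ℝ → E} {a b a' K l : ℝ} (h : SqInt f a b) (ha : a ≤ a') (hK : 0 ≤ K)
    (hl : 0 < l) (T : Tab f a b a' K (l / 2)) : Tab f a b a' K l := by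
  have hl2 : 0 < l / 2 := by linarith
  have x0 : PX f a b a' K 0 (37 / 4) l :=
    rowXsub h ha hK hl (1 / 9) (by norm_num) (β' := 47 / 4) (T.y0.mono hK hl2 (by norm_num))
      (T.y1.mono hK hl2 (by norm_num)) (by norm_num) (by norm_num) (by norm_num)
  have x1 : PX f a b a' K 1 (33 / 2) l :=
    rowXsub h ha hK hl (1 / 9) (by norm_num) (β' := 81 / 4) (T.y2.mono hK hl2 (by norm_num))
      (T.y3.mono hK hl2 (by norm_num)) (by norm_num) (by norm_num) (by norm_num)
  have y0 : PY f a b a' K 0 (47 / 4) l :=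
    rowYsub h ha hK hl (1 / 10) (by norm_num) (β' := 33 / 2) (T.x0.mono hK hl2 (by norm_num))
      (T.x1.mono hK hl2 (by norm_num)) (by norm_num) (by norm_num) (by norm_num)
  have y1 : PY f a b a' K 1 (29 / 4) l :=
    rowBY1 h ha hK hl (1 / 4) (by norm_num) (i := 0) (β' := 47 / 4) (by norm_num)
      (T.y0.mono hK hl2 (by norm_num))
      (T.y1.mono hK hl2 (by norm_num)) (by norm_num) (by norm_num) (by norm_num) (by norm_num)
  have y2 : PY f a b a' K 2 (73 / 4) l :=
    rowBY1 h ha hK hl (1 / 4) (by norm_num) (i := 1) (β' := 81 / 4) (by norm_num)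
      (T.y2.mono hK hl2 (by norm_num))
      (T.y3.mono hK hl2 (by norm_num)) (by norm_num) (by norm_num) (by norm_num) (by norm_num)
  have y3 : PY f a b a' K 3 (81 / 4) l :=
    rowBY1 h ha hK hl (2 / 7) (by norm_num) (i := 2) (β' := 57 / 4) (by norm_num)
      (T.y4.mono hK hl2 (by norm_num))
      (T.y5.mono hK hl2 (by norm_num)) (by norm_num) (by norm_num) (by norm_num) (by norm_num)
  have x2 : PX f a b a' K 2 4 l :=
    rowBX0 h ha hK hl (1 / 8) (by norm_num) (i := 0) (by norm_num) y0 (by norm_num) (by norm_num)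
  have x3 : PX f a b a' K 3 (5 / 2) l :=
    rowBX0 h ha hK hl (1 / 6) (by norm_num) (i := 1) (by norm_num) y1 (by norm_num) (by norm_num)
  have x4 : PX f a b a' K 4 19 l :=
    rowBX0 h ha hK hl (1 / 7) (by norm_num) (i := 2) (by norm_num) y2 (by norm_num) (by norm_num)
  have x5 : PX f a b a' K 5 25 l :=
    rowBX0 h ha hK hl (1 / 6) (by norm_num) (i := 3) (by norm_num) y3 (by norm_num) (by norm_num)
  have y4 : PY f a b a' K 4 0 l :=
    rowBY0 h ha hK hl (2 / 7) (by norm_num) (i := 0) (by norm_num) x0 (by norm_num) (by norm_num)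
  have y5 : PY f a b a' K 5 (57 / 4) l :=
    rowBY0 h ha hK hl (2 / 7) (by norm_num) (i := 1) (by norm_num) x1 (by norm_num) (by norm_num)
  have y6 : PY f a b a' K 6 (23 / 4) l :=
    rowBY0 h ha hK hl (2 / 5) (by norm_num) (i := 2) (by norm_num) x2 (by norm_num) (by norm_num)
  have y7 : PY f a b a' K 7 (23 / 2) l :=
    rowBY0 h ha hK hl (2 / 5) (by norm_num) (i := 3) (by norm_num) x3 (by norm_num) (by norm_num)
  have x6 : PX f a b a' K 6 (19 / 4) l :=
    rowBX0 h ha hK hl (1 / 5) (by norm_num) (i := 4) (by norm_num) y4 (by norm_num) (by norm_num)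
  have x7 : PX f a b a' K 7 (51 / 2) l :=
    rowBX0 h ha hK hl (1 / 6) (by norm_num) (i := 5) (by norm_num) y5 (by norm_num) (by norm_num)
  have x8 : PX f a b a' K 8 19 l :=
    rowBX0 h ha hK hl (1 / 5) (by norm_num) (i := 6) (by norm_num) y6 (by norm_num) (by norm_num)
  exact ⟨x0, x1, x2, x3, x4, x5, x6, x7, x8, y0, y1, y2, y3, y4, y5, y6, y7⟩

lemma PX.base {f : ℝ → E} {a b a' K l i β : ℝ} (hK : 0 ≤ K) (hl : 0 < l)
    (hs : 3 / 2 * l ≤ a' - a) (hi : i ≤ 8) (hβ : 0 ≤ β) : PX f a b a' K i β l := by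
  intro p _ hap _ _ hhi
  have : devS f a' p (avgS f p l) = 0 := by
    unfold devS; rw [Set.Ioc_eq_empty (by nlinarith)]; simp
  rw [this]
  have : 0 ≤ p - a := by linarith
  positivity
lemma PY.base {f : ℝ → E} {a b a' K l i β : ℝ} (hK : 0 ≤ K) (hl : 0 < l)
    (hs : 3 / 2 * l ≤ a' - a) (hi : i ≤ 8) (hβ : 0 ≤ β) : PY f a b a' K i β l := by
  intro p _ hap _ _ hhi
  have : devS f a' p (avgS f p l) = 0 := by
    unfold devS; rw [Set.Ioc_eq_empty (by nlinarith)]; simp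
  rw [this]
  have : 0 ≤ p - a := by linarith
  positivity

lemma Tab.ind {f : ℝ → E} {a b a' K : ℝ} (h : SqInt f a b) (ha : a ≤ a') (hK : 0 ≤ K) (N : ℕ) :
    ∀ l, 0 < l → 3 / 2 * l ≤ 2 ^ N * (a' - a) → Tab f a b a' K l := by
  induction N with
  | zero =>
    intro l hl hs
    have hs : 3 / 2 * l ≤ a' - a := by simpa using hs
    constructor <;> first
      | exact PX.base hK hl hs (by norm_num) (by norm_num)
      | exact PY.base hK hl hs (by norm_num) (by norm_num)
  | succ N ih =>
    intro l hl hs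
    refine Tab.step h ha hK hl (ih _ (by linarith) ?_)
    rw [pow_succ] at hs
    linarith

lemma Tab.all {f : ℝ → E} {a b a' K l : ℝ} (h : SqInt f a b) (ha : a < a') (hK : 0 ≤ K)
    (hl : 0 < l) : Tab f a b a' K l := by
  obtain ⟨N, hN⟩ := pow_unbounded_of_one_lt (3 / 2 * l / (a' - a)) (one_lt_two (α := ℝ))
  refine Tab.ind h ha.le hK N l hl ?_
  have h0 : 0 < a' - a := by linarith
  rw [div_lt_iff₀ h0] at hN
  exact hN.le

lemma boundX' {f : ℝ → E} {a b a' K l p : ℝ} (h : SqInt f a b) (ha : a < a') (hK : 0 ≤ K)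
    (hl : 0 < l) (hS : SX f a b K p l) (hap : a ≤ p) (hpb : p + l ≤ b) (hr : p - a < 3 / 2 * l) :
    devS f a' p (avgS f p l) ≤ K * (48 * (p - a) + 51 / 2 * l) := by
  have T := Tab.all (l := l) h ha hK hl
  by_cases c0 : p - a < (0 + 1) / 6 * l
  · exact T.x0.mono hK hl (by norm_num) p hS hap hpb (by linarith) c0
  by_cases c1 : p - a < (1 + 1) / 6 * l
  · exact T.x1.mono hK hl (by norm_num) p hS hap hpb (by linarith) c1
  by_cases c2 : p - a < (2 + 1) / 6 * l
  · exact T.x2.mono hK hl (by norm_num) p hS hap hpb (by linarith) c2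
  by_cases c3 : p - a < (3 + 1) / 6 * l
  · exact T.x3.mono hK hl (by norm_num) p hS hap hpb (by linarith) c3
  by_cases c4 : p - a < (4 + 1) / 6 * l
  · exact T.x4.mono hK hl (by norm_num) p hS hap hpb (by linarith) c4
  by_cases c5 : p - a < (5 + 1) / 6 * l
  · exact T.x5.mono hK hl (by norm_num) p hS hap hpb (by linarith) c5
  by_cases c6 : p - a < (6 + 1) / 6 * l
  · exact T.x6.mono hK hl (by norm_num) p hS hap hpb (by linarith) c6
  by_cases c7 : p - a < (7 + 1) / 6 * l
  · exact T.x7.mono hK hl (by norm_num) p hS hap hpb (by linarith) c7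
  · exact T.x8.mono hK hl (by norm_num) p hS hap hpb (by linarith) (by linarith)

lemma boundY' {f : ℝ → E} {a b a' K l p : ℝ} (h : SqInt f a b) (ha : a < a') (hK : 0 ≤ K)
    (hl : 0 < l) (hS : SY f a b K p l) (hap : a ≤ p) (hpb : p + l ≤ b) (hr : p - a < 4 / 3 * l) :
    devS f a' p (avgS f p l) ≤ K * (48 * (p - a) + 81 / 4 * l) := by
  have T := Tab.all (l := l) h ha hK hl
  by_cases c0 : p - a < (0 + 1) / 6 * l
  · exact T.y0.mono hK hl (by norm_num) p hS hap hpb (by linarith) c0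
  by_cases c1 : p - a < (1 + 1) / 6 * l
  · exact T.y1.mono hK hl (by norm_num) p hS hap hpb (by linarith) c1
  by_cases c2 : p - a < (2 + 1) / 6 * l
  · exact T.y2.mono hK hl (by norm_num) p hS hap hpb (by linarith) c2
  by_cases c3 : p - a < (3 + 1) / 6 * l
  · exact T.y3.mono hK hl (by norm_num) p hS hap hpb (by linarith) c3
  by_cases c4 : p - a < (4 + 1) / 6 * l
  · exact T.y4.mono hK hl (by norm_num) p hS hap hpb (by linarith) c4
  by_cases c5 : p - a < (5 + 1) / 6 * l
  · exact T.y5.mono hK hl (by norm_num) p hS hap hpb (by linarith) c5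
  by_cases c6 : p - a < (6 + 1) / 6 * l
  · exact T.y6.mono hK hl (by norm_num) p hS hap hpb (by linarith) c6
  · exact T.y7.mono hK hl (by norm_num) p hS hap hpb (by linarith) (by linarith)

/-- Removing the cut-off at the left end. -/
lemma devS_lim {f : ℝ → E} {a b p C : ℝ} (h : SqInt f a b) (hap : a ≤ p) (hpb : p ≤ b) (c : E)
    (hC : ∀ a' > a, devS f a' p c ≤ C) : devS f a p c ≤ C := by
  have hi : IntegrableOn (fun y => ‖f y - c‖ ^ 2) (Set.Ioc a p) := (h.mono le_rfl hpb).2 c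
  rcases hap.eq_or_lt with rfl | hlt
  · have h1 := hC (a + 1) (by linarith)
    have h2 := devS_nonneg f (a + 1) a c
    have h3 : devS f a a c = 0 := by unfold devS; simp
    linarith
  have hcont : ContinuousOn (fun x => ∫ y in x..p, ‖f y - c‖ ^ 2) (Set.uIcc a p) := by
    apply intervalIntegral.continuousOn_primitive_interval_left
    rw [Set.uIcc_of_le hap]
    exact (integrableOn_Icc_iff_integrableOn_Ioc (by simp)).2 hi
  have h1 := (hcont a Set.left_mem_uIcc).mono_left
    (nhdsWithin_mono a (t := Set.uIcc a p) (s := Set.Ioc a p)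
      (by rw [Set.uIcc_of_le hap]; exact Set.Ioc_subset_Icc_self))
  have hne : (nhdsWithin a (Set.Ioc a p)).NeBot := by
    rw [nhdsWithin_Ioc_eq_nhdsGT hlt]; infer_instance
  have h2 := le_of_tendsto h1 (b := C) (by
    filter_upwards [self_mem_nhdsWithin] with x hx
    rw [intervalIntegral.integral_of_le hx.2]
    exact hC x hx.1)
  simp only at h2
  rw [intervalIntegral.integral_of_le hap] at h2
  exact h2

lemma boundX {f : ℝ → E} {a b K l p : ℝ} (h : SqInt f a b) (hK : 0 ≤ K)
    (hl : 0 < l) (hS : SX f a b K p l) (hap : a ≤ p) (hpb : p + l ≤ b) (hr : p - a < 3 / 2 * l) :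
    devS f a p (avgS f p l) ≤ K * (48 * (p - a) + 51 / 2 * l) :=
  devS_lim h hap (by linarith) _ fun _ ha => boundX' h ha hK hl hS hap hpb hr
lemma boundY {f : ℝ → E} {a b K l p : ℝ} (h : SqInt f a b) (hK : 0 ≤ K)
    (hl : 0 < l) (hS : SY f a b K p l) (hap : a ≤ p) (hpb : p + l ≤ b) (hr : p - a < 4 / 3 * l) :
    devS f a p (avgS f p l) ≤ K * (48 * (p - a) + 81 / 4 * l) :=
  devS_lim h hap (by linarith) _ fun _ ha => boundY' h ha hK hl hS hap hpb hr

end Rows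

section Refl
variable {E : Type*} [NormedAddCommGroup E] [InnerProductSpace ℝ E] [CompleteSpace E]

lemma int_neg {F : Type*} [NormedAddCommGroup F] [NormedSpace ℝ F] (f : ℝ → F) {x z : ℝ}
    (h : x ≤ z) : ∫ y in Set.Ioc (-z) (-x), f (-y) = ∫ y in Set.Ioc x z, f y := by
  rw [← intervalIntegral.integral_of_le (by linarith), ← intervalIntegral.integral_of_le h,
    intervalIntegral.integral_comp_neg, neg_neg, neg_neg]

lemma integrableOn_neg {F : Type*} [NormedAddCommGroup F] {f : ℝ → F} {x z : ℝ}
    (hf : IntegrableOn f (Set.Ioc x z)) : IntegrableOn (fun y => f (-y)) (Set.Ioc (-z) (-x)) := by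
  rcases le_total x z with h | h
  · rw [← intervalIntegrable_iff_integrableOn_Ioc_of_le (by linarith)]
    rw [← intervalIntegrable_iff_integrableOn_Ioc_of_le h] at hf
    have := (IntervalIntegrable.iff_comp_neg (f := f) (a := x) (b := z)).1 hf
    exact this.symm
  · rw [Set.Ioc_eq_empty (by linarith)]; simp

lemma SqInt.neg {f : ℝ → E} {a b : ℝ} (h : SqInt f a b) : SqInt (fun y => f (-y)) (-b) (-a) :=
  ⟨integrableOn_neg h.1, fun c => integrableOn_neg (h.2 c)⟩

lemma devS_neg (f : ℝ → E) {x z : ℝ} (h : x ≤ z) (c : E) :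
    devS (fun y => f (-y)) (-z) (-x) c = devS f x z c :=
  int_neg (fun y => ‖f y - c‖ ^ 2) h

lemma avgS_neg (f : ℝ → E) {x s : ℝ} (h : 0 ≤ s) :
    avgS (fun y => f (-y)) (-(x + s)) s = avgS f x s := by
  unfold avgS
  rw [show -(x + s) + s = -x by ring, int_neg f (by linarith)]

lemma Gd.neg {f : ℝ → E} {a b K p l : ℝ} (hl : 0 < l) (h : Gd f a b K p l) :
    Gd (fun y => f (-y)) (-b) (-a) K (-p) l := by
  intro k m h1 h2
  have hs : 0 < l / 2 ^ k := by positivity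
  have := h k (-m - 1)
  set s := l / 2 ^ k
  set x := p + ((-m - 1 : ℤ) : ℝ) * s with hx
  have e : -p + m * s = -(x + s) := by rw [hx]; push_cast; ring
  rw [e] at h1 h2 ⊢
  have e2 : -(x + s) + s = -x := by ring
  rw [e2] at h2 ⊢
  rw [devS_neg f (by linarith), avgS_neg f hs.le]
  exact this (by linarith) (by linarith)

lemma SX.neg {f : ℝ → E} {a b K p l : ℝ} (hl : 0 < l) (h : SX f a b K p l) :
    SY (fun y => f (-y)) (-b) (-a) K (-(p + l)) l :=
  ⟨(h.1.neg hl).shift (-1) (by push_cast; ring), (h.2.neg hl).shift (-1) (by push_cast; ring)⟩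
lemma SY.neg {f : ℝ → E} {a b K p l : ℝ} (hl : 0 < l) (h : SY f a b K p l) :
    SX (fun y => f (-y)) (-b) (-a) K (-(p + l)) l :=
  ⟨(h.1.neg hl).shift (-1) (by push_cast; ring), (h.2.neg hl).shift (-1) (by push_cast; ring)⟩

lemma devS_min {f : ℝ → E} {a b : ℝ} (h : SqInt f a b) (hab : a < b) (c : E) :
    devS f a b (avgS f a (b - a)) ≤ devS f a b c := by
  set m := avgS f a (b - a) with hm
  have e : ∫ w in Set.Ioc a b, f w = (b - a) • m := by
    rw [hm, ← avg_int (by linarith)]; congr 2; ring_nf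
  have := devS_expand h hab.le m (c - m)
  rw [e, sub_self, inner_zero_right, add_sub_cancel] at this
  have h0 : 0 ≤ (b - a) * ‖c - m‖ ^ 2 := mul_nonneg (by linarith) (by positivity)
  linarith

lemma comb {f : ℝ → E} {a b K l p L R : ℝ} (h : SqInt f a b) (hK : 0 ≤ K) (hl : 0 < l)
    (hG : Gd f a b K p l) (hap : a ≤ p) (hpb : p + l ≤ b)
    (h1 : devS f a p (avgS f p l) ≤ K * (48 * (p - a) + L * l))
    (h2 : devS f (p + l) b (avgS f p l) ≤ K * (48 * (b - (p + l)) + R * l)) (hLR : L + R ≤ 47) :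
    devS f a b (avgS f a (b - a)) ≤ 48 * K * (b - a) := by
  refine (devS_min h (by linarith) (avgS f p l)).trans ?_
  rw [devS_split h hap (by linarith), devS_split (h.mono hap le_rfl) (y := p + l) (by linarith) hpb]
  have h3 := hG.self hap hpb
  have h4 : (L + R) * (K * l) ≤ 47 * (K * l) := mul_le_mul_of_nonneg_right hLR (by positivity)
  linarith

lemma combX {f : ℝ → E} {a b K l p : ℝ} (h : SqInt f a b) (hK : 0 ≤ K) (hl : 0 < l)
    (hS : SX f a b K p l) (hap : a ≤ p) (hpb : p + l ≤ b)
    (h1 : p - a < 3 / 2 * l) (h2 : b - (p + l) < 4 / 3 * l) :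
    devS f a b (avgS f a (b - a)) ≤ 48 * K * (b - a) := by
  have hr := boundY h.neg hK hl (hS.neg hl) (by linarith) (by linarith) (by linarith)
  rw [devS_neg f hpb, avgS_neg f hl.le] at hr
  exact comb h hK hl hS.1 hap hpb (boundX h hK hl hS hap hpb h1)
    (hr.trans (le_of_eq (by ring))) (R := 81 / 4) (by norm_num)

lemma combY {f : ℝ → E} {a b K l p : ℝ} (h : SqInt f a b) (hK : 0 ≤ K) (hl : 0 < l)
    (hS : SY f a b K p l) (hap : a ≤ p) (hpb : p + l ≤ b)
    (h1 : p - a < 4 / 3 * l) (h2 : b - (p + l) < 3 / 2 * l) :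
    devS f a b (avgS f a (b - a)) ≤ 48 * K * (b - a) := by
  have hr := boundX h.neg hK hl (hS.neg hl) (by linarith) (by linarith) (by linarith)
  rw [devS_neg f hpb, avgS_neg f hl.le] at hr
  exact comb h hK hl hS.1 hap hpb (boundY h hK hl hS hap hpb h1)
    (hr.trans (le_of_eq (by ring))) (R := 51 / 2) (by norm_num)

/-- Main local estimate. -/
lemma local_est {f : ℝ → E} {a b K h x' : ℝ} (hf : SqInt f a b) (hK : 0 ≤ K) (hh : 0 < h)
    (hlo : 5 / 3 * h ≤ b - a) (hhi : b - a < 10 / 3 * h)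
    (g1 : Gd f a b K x' (2 * h)) (g2 : Gd f a b K (x' + 2 * h / 3) (2 * h)) :
    devS f a b (avgS f a (b - a)) ≤ 48 * K * (b - a) := by
  obtain ⟨k, hk1, hk2⟩ : ∃ k : ℤ, x' + 2 * h / 3 + k * h ≤ a ∧ a < x' + 2 * h / 3 + k * h + h := by
    refine ⟨⌊(a - (x' + 2 * h / 3)) / h⌋, ?_, ?_⟩
    · have := Int.floor_le ((a - (x' + 2 * h / 3)) / h)
      rw [le_div_iff₀ hh] at this
      linarith
    · have := Int.lt_floor_add_one ((a - (x' + 2 * h / 3)) / h)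
      rw [div_lt_iff₀ hh] at this
      linarith
  obtain ⟨x, hx⟩ : ∃ x, x = x' + 2 * h / 3 + k * h := ⟨_, rfl⟩
  rw [← hx] at hk1 hk2
  have u : ∀ j : ℤ, Gd f a b K (x + j * h) h := fun j =>
    (g2.half (l' := h) (by ring)).shift (k + j) (by rw [hx]; push_cast; ring)
  have v : ∀ j : ℤ, Gd f a b K (x + h / 3 + j * h) h := fun j =>
    (g1.half (l' := h) (by ring)).shift (k + j + 1) (by rw [hx]; push_cast; ring)
  have sU : ∀ j : ℤ, SY f a b K (x + j * h) h := fun j =>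
    ⟨u j, (v j).shift 0 (by push_cast; ring)⟩
  have sV : ∀ j : ℤ, SX f a b K (x + h / 3 + j * h) h := fun j =>
    ⟨v j, (u j).shift 0 (by push_cast; ring)⟩
  have U1 := sU 1
  have U2 := sU 2
  have V0 := sV 0
  have V1 := sV 1
  push_cast at U1 U2 V0 V1
  rcases le_or_gt (a - x) (h / 3) with c1 | c1
  · rcases lt_or_ge (b - x) (2 * h) with d1 | d1
    · exact combX hf hK hh V0 (by linarith) (by linarith) (by linarith) (by linarith)
    rcases lt_or_ge (b - x) (7 / 2 * h) with d2 | d2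
    · exact combY hf hK hh U1 (by linarith) (by linarith) (by linarith) (by linarith)
    · exact combX hf hK hh V1 (by linarith) (by linarith) (by linarith) (by linarith)
  rcases le_or_gt (a - x) (2 * h / 3) with c2 | c2
  · rcases lt_or_ge (b - x) (7 / 2 * h) with d2 | d2
    · exact combY hf hK hh U1 (by linarith) (by linarith) (by linarith) (by linarith)
    rcases lt_or_ge (b - x) (11 / 3 * h) with d3 | d3
    · exact combX hf hK hh V1 (by linarith) (by linarith) (by linarith) (by linarith)
    rcases Int.even_or_odd' k with ⟨j, hj | hj⟩
    · have S : SY f a b K (x + 4 * h / 3) (2 * h) :=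
        ⟨g1.shift (j + 1) (by rw [hx, hj]; push_cast; ring),
          g2.shift (j + 1) (by rw [hx, hj]; push_cast; ring)⟩
      exact combY hf hK (by linarith) S (by linarith) (by linarith) (by linarith) (by linarith)
    · have S : SX f a b K (x + h) (2 * h) :=
        ⟨g2.shift (j + 1) (by rw [hx, hj]; push_cast; ring),
          g1.shift (j + 1) (by rw [hx, hj]; push_cast; ring)⟩
      exact combX hf hK (by linarith) S (by linarith) (by linarith) (by linarith) (by linarith)
  · rcases lt_or_ge (b - x) (7 / 2 * h) with d2 | d2
    · exact combY hf hK hh U1 (by linarith) (by linarith) (by linarith) (by linarith)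
    · exact combY hf hK hh U2 (by linarith) (by linarith) (by linarith) (by linarith)

end Refl

section Grids

lemma dyadicL'_step (n i : ℤ) : ∃ j, dyadicL' n i = dyadicL' (n + 1) j := by
  have e : (2 : ℝ) ^ (-n) = 2 * 2 ^ (-(n + 1)) := by
    rw [show -n = 1 + -(n + 1) by ring, zpow_add₀ two_ne_zero, zpow_one]
  unfold dyadicL'
  rcases Int.even_or_odd n with h | h
  · have h' : ¬ Even (n + 1) := by rw [Int.even_add_one]; simpa using h
    refine ⟨2 * i, ?_⟩
    rw [if_pos h, if_neg h', e]; push_cast; ring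
  · have h' : Even (n + 1) := h.add_one
    refine ⟨2 * i + 1, ?_⟩
    rw [if_neg (by simpa using h), if_pos h', e]; push_cast; ring

lemma dyadicL'_steps (n : ℤ) (k : ℕ) : ∃ j, dyadicL' n 0 = dyadicL' (n + k) j := by
  induction k with
  | zero => exact ⟨0, by simp⟩
  | succ k ih =>
    obtain ⟨j, hj⟩ := ih
    obtain ⟨j', hj'⟩ := dyadicL'_step (n + k) j
    exact ⟨j', by rw [hj, hj']; push_cast; ring_nf⟩

lemma dyadicL'_add (n j m : ℤ) : dyadicL' n j + m * (2 : ℝ) ^ (-n) = dyadicL' n (j + m) := by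
  unfold dyadicL'
  split_ifs <;> push_cast <;> ring

lemma scale_eq (n : ℤ) (k : ℕ) : (2 : ℝ) ^ (-n) / 2 ^ k = 2 ^ (-(n + k)) := by
  rw [neg_add, zpow_add₀ two_ne_zero, zpow_neg 2 (k : ℤ), zpow_natCast]; rfl

variable {E : Type*} [NormedAddCommGroup E] [InnerProductSpace ℝ E] [CompleteSpace E]

lemma grid_pair {f : ℝ → E} {a b K : ℝ}
    (h1 : ∀ n k : ℤ, a ≤ dyadicL n k → dyadicL n k + (2 : ℝ) ^ (-n) ≤ b →
      devS f (dyadicL n k) (dyadicL n k + (2 : ℝ) ^ (-n)) (avgS f (dyadicL n k) ((2 : ℝ) ^ (-n)))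
        ≤ K * (2 : ℝ) ^ (-n))
    (h2 : ∀ n k : ℤ, a ≤ dyadicL' n k → dyadicL' n k + (2 : ℝ) ^ (-n) ≤ b →
      devS f (dyadicL' n k) (dyadicL' n k + (2 : ℝ) ^ (-n)) (avgS f (dyadicL' n k) ((2 : ℝ) ^ (-n)))
        ≤ K * (2 : ℝ) ^ (-n)) (n : ℤ) :
    ∃ x, Gd f a b K x (2 ^ (-n)) ∧ Gd f a b K (x + 2 ^ (-n) / 3) (2 ^ (-n)) := by
  have g1 : Gd f a b K 0 (2 ^ (-n)) := by
    intro k m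
    have e : (0 : ℝ) + m * (2 ^ (-n) / 2 ^ k) = dyadicL (n + k) m := by
      rw [scale_eq, zero_add]; rfl
    rw [e, scale_eq]
    exact h1 _ _
  have g2 : Gd f a b K (dyadicL' n 0) (2 ^ (-n)) := by
    intro k m
    obtain ⟨j, hj⟩ := dyadicL'_steps n k
    rw [scale_eq, hj, dyadicL'_add]
    exact h2 _ _
  rcases Int.even_or_odd n with h | h
  · refine ⟨0, g1, g2.shift 0 ?_⟩
    unfold dyadicL'
    rw [if_pos h]; push_cast; ring
  · refine ⟨dyadicL' n 0, g2, g1.shift 1 ?_⟩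
    unfold dyadicL'
    rw [if_neg (by simpa using h)]; push_cast; ring

lemma all_est {f : ℝ → E} {a b K : ℝ} (hf : SqInt f a b) (hK : 0 ≤ K) (hab : a < b)
    (h1 : ∀ n k : ℤ, a ≤ dyadicL n k → dyadicL n k + (2 : ℝ) ^ (-n) ≤ b →
      devS f (dyadicL n k) (dyadicL n k + (2 : ℝ) ^ (-n)) (avgS f (dyadicL n k) ((2 : ℝ) ^ (-n)))
        ≤ K * (2 : ℝ) ^ (-n))
    (h2 : ∀ n k : ℤ, a ≤ dyadicL' n k → dyadicL' n k + (2 : ℝ) ^ (-n) ≤ b →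
      devS f (dyadicL' n k) (dyadicL' n k + (2 : ℝ) ^ (-n)) (avgS f (dyadicL' n k) ((2 : ℝ) ^ (-n)))
        ≤ K * (2 : ℝ) ^ (-n)) :
    devS f a b (avgS f a (b - a)) ≤ 48 * K * (b - a) := by
  obtain ⟨m, hm1, hm2⟩ := exists_mem_Ico_zpow (x := 3 * (b - a) / 5) (y := 2) (by linarith)
    one_lt_two
  have e : (2 : ℝ) ^ (m + 1) = 2 * 2 ^ m := by
    rw [zpow_add₀ two_ne_zero, zpow_one, mul_comm]
  obtain ⟨x, g1, g2⟩ := grid_pair h1 h2 (-(m + 1))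
  rw [neg_neg, e] at g1 g2
  rw [e] at hm2
  exact local_est hf hK (by positivity) (by linarith) (by linarith) g1 g2

end Grids

section Final

attribute [local instance] InnerProductSpace.complexToReal

lemma intervalAvg_apply {φ : ℝ → H →L[ℂ] H} (hφ : LocallyIntegrable φ volume) (a b : ℝ) (v : H) :
    intervalAvg φ a b v = avgS (fun s => φ s v) a (b - a) := by
  have hi : IntegrableOn φ (Set.Ioc a b) :=
    (hφ.integrableOn_isCompact isCompact_Icc).mono_set Set.Ioc_subset_Icc_self
  unfold intervalAvg avgS
  rw [smul_apply, ContinuousLinearMap.integral_apply hi, add_sub_cancel]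

lemma bmoOn_eq {φ : ℝ → H →L[ℂ] H} (hφ : LocallyIntegrable φ volume) (a b : ℝ) (v : H) :
    bmoOn φ a b v = Real.sqrt ((b - a)⁻¹ *
      devS (fun s => φ s v) a b (avgS (fun s => φ s v) a (b - a))) := by
  unfold bmoOn devS
  rw [← intervalAvg_apply hφ]
  rfl

lemma sqInt_of {φ : ℝ → H →L[ℂ] H} (hφ : LocallyIntegrable φ volume) (a b : ℝ) (v c : H)
    (h : IntegrableOn (fun s => ‖φ s v - c‖ ^ 2) (Set.Ioc a b)) : SqInt (fun s => φ s v) a b := by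
  have hi : IntegrableOn φ (Set.Ioc a b) :=
    (hφ.integrableOn_isCompact isCompact_Icc).mono_set Set.Ioc_subset_Icc_self
  have hf : IntegrableOn (fun s => φ s v) (Set.Ioc a b) := hi.apply_continuousLinearMap v
  refine ⟨hf, fun d => ?_⟩
  have m1 : MemLp (fun s => φ s v - c) 2 (volume.restrict (Set.Ioc a b)) :=
    (memLp_two_iff_integrable_sq_norm (hf.1.sub aestronglyMeasurable_const)).2 h
  have m2 : MemLp (fun _ : ℝ => c - d) 2 (volume.restrict (Set.Ioc a b)) := memLp_const _
  have m3 := m1.add m2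
  have m4 := (memLp_two_iff_integrable_sq_norm m3.1).1 m3
  refine m4.congr (Filter.Eventually.of_forall fun s => ?_)
  simp

lemma devS_of_bmoOn {φ : ℝ → H →L[ℂ] H} (hφ : LocallyIntegrable φ volume) {x s M : ℝ} (v : H)
    (hs : 0 < s) (hM : 0 ≤ M) (h : bmoOn φ x (x + s) v ≤ M) :
    devS (fun s => φ s v) x (x + s) (avgS (fun s => φ s v) x s) ≤ M ^ 2 * s := by
  rw [bmoOn_eq hφ, Real.sqrt_le_left hM, add_sub_cancel_left, inv_mul_le_iff₀ hs] at h
  linarith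

lemma bmoOn_le {φ : ℝ → H →L[ℂ] H} (hφ : LocallyIntegrable φ volume) {M : ℝ} (hM : 0 ≤ M) (v : H)
    (h1 : ∀ n k : ℤ, bmoOn φ (dyadicL n k) (dyadicL n k + (2 : ℝ) ^ (-n)) v ≤ M)
    (h2 : ∀ n k : ℤ, bmoOn φ (dyadicL' n k) (dyadicL' n k + (2 : ℝ) ^ (-n)) v ≤ M)
    {a b : ℝ} (hab : a < b) : bmoOn φ a b v ≤ 4 * Real.sqrt 3 * M := by
  have h0 : 0 < b - a := by linarith
  have hR : 0 ≤ 4 * Real.sqrt 3 * M := by positivity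
  rw [bmoOn_eq hφ, Real.sqrt_le_left hR, inv_mul_le_iff₀ h0, mul_pow, mul_pow,
    Real.sq_sqrt (by norm_num)]
  by_cases hi : IntegrableOn (fun s => ‖φ s v - avgS (fun s => φ s v) a (b - a)‖ ^ 2) (Set.Ioc a b)
  · have := all_est (sqInt_of hφ a b v _ hi) (K := M ^ 2) (by positivity) hab
      (fun n k _ _ => devS_of_bmoOn hφ v (by positivity) hM (h1 n k))
      (fun n k _ _ => devS_of_bmoOn hφ v (by positivity) hM (h2 n k))
    linarith
  · unfold devS
    rw [integral_undef hi]
    positivity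

end Final

/-- BMO is the intersection of the two dyadic BMO spaces:
`max(‖φ‖_{BMO_c^D}, ‖φ‖_{BMO_c^{D'}}) ≤ ‖φ‖_{BMO_c} ≤ 4√3·max(‖φ‖_{BMO_c^D}, ‖φ‖_{BMO_c^{D'}})`
in `[0, ∞]`. -/
theorem stmt19 (φ : ℝ → H →L[ℂ] H) (hφ : LocallyIntegrable φ volume) :
    bmoCNormD φ ⊔ bmoCNormD' φ ≤ bmoCNorm φ ∧
      bmoCNorm φ ≤ ENNReal.ofReal (4 * Real.sqrt 3) * (bmoCNormD φ ⊔ bmoCNormD' φ) := by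
  constructor
  · refine sup_le ?_ ?_
    · refine iSup_le fun n => iSup_le fun k => iSup_le fun v => iSup_le fun hv => ?_
      exact le_iSup_of_le _ (le_iSup_of_le _ (le_iSup_of_le
        (lt_add_of_pos_right _ (by positivity)) (le_iSup_of_le v (le_iSup_of_le hv le_rfl))))
    · refine iSup_le fun n => iSup_le fun k => iSup_le fun v => iSup_le fun hv => ?_
      exact le_iSup_of_le _ (le_iSup_of_le _ (le_iSup_of_le
        (lt_add_of_pos_right _ (by positivity)) (le_iSup_of_le v (le_iSup_of_le hv le_rfl))))
  · by_cases hT : bmoCNormD φ ⊔ bmoCNormD' φ = ⊤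
    · rw [hT, ENNReal.mul_top (by simp)]
      exact le_top
    · set T := bmoCNormD φ ⊔ bmoCNormD' φ with hTd
      refine iSup_le fun a => iSup_le fun b => iSup_le fun hab => iSup_le fun v =>
        iSup_le fun hv => ?_
      have hD : ∀ n k : ℤ,
          bmoOn φ (dyadicL n k) (dyadicL n k + (2 : ℝ) ^ (-n)) v ≤ T.toReal := by
        intro n k
        rw [← ENNReal.ofReal_le_iff_le_toReal hT]
        refine le_trans ?_ (le_sup_left : bmoCNormD φ ≤ T)
        exact le_iSup_of_le n (le_iSup_of_le k (le_iSup_of_le v (le_iSup_of_le hv le_rfl)))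
      have hD' : ∀ n k : ℤ,
          bmoOn φ (dyadicL' n k) (dyadicL' n k + (2 : ℝ) ^ (-n)) v ≤ T.toReal := by
        intro n k
        rw [← ENNReal.ofReal_le_iff_le_toReal hT]
        refine le_trans ?_ (le_sup_right : bmoCNormD' φ ≤ T)
        exact le_iSup_of_le n (le_iSup_of_le k (le_iSup_of_le v (le_iSup_of_le hv le_rfl)))
      have := bmoOn_le hφ ENNReal.toReal_nonneg v hD hD' hab
      calc ENNReal.ofReal (bmoOn φ a b v)
          ≤ ENNReal.ofReal (4 * Real.sqrt 3 * T.toReal) := ENNReal.ofReal_le_ofReal this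
        _ = ENNReal.ofReal (4 * Real.sqrt 3) * T := by
          rw [ENNReal.ofReal_mul (by positivity), ENNReal.ofReal_toReal hT]
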